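/- Let μ be a positive Borel measure on ℝ, r > 0, and v : ℝ → ℂ measurable with v ∈ L²(μ) and e^{rλ} v ∈ L²(μ). Then for every z ∈ ℂ with 0 ≤ Re z ≤ r the function λ ↦ e^{zλ} v(λ) lies in L²(μ), the map F : {z : 0 ≤ Re z ≤ r} → L²(μ), F(z) = e^{zλ} v, is continuous, and F is holomorphic (complex differentiable) on the open strip {z : 0 < Re z < r}. -/

import Mathlib

open MeasureTheory Filter Real Set Complex

open scoped Topology

/-- Dominated convergence in `Lp`, for a family with prescribed almost everywhere representatives. -/
theorem tendsto_Lp_of_dominated {α ι E : Type*} [MeasurableSpace α] [NormedAddCommGroup E]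
    {μ : Measure α} {p : ENNReal} [Fact (1 ≤ p)] (hp : p ≠ ⊤) {l : Filter ι}
    [l.IsCountablyGenerated] {F : ι → Lp E p μ} {G : Lp E p μ} {f : ι → α → E} {g : α → E}
    {b : α → ℝ} (hF : ∀ᶠ i in l, F i =ᵐ[μ] f i) (hG : G =ᵐ[μ] g) (hb : MemLp b p μ)
    (hfb : ∀ᶠ i in l, ∀ᵐ a ∂μ, ‖f i a‖ ≤ b a)
    (hlim : ∀ᵐ a ∂μ, Tendsto (fun i => f i a) l (𝓝 (g a))) :
    Tendsto F l (𝓝 G) := by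
  have hp0 : p ≠ 0 := (zero_lt_one.trans_le Fact.out).ne'
  have hpos : 0 < p.toReal := ENNReal.toReal_pos hp0 hp
  have hg : MemLp g p μ := (memLp_congr_ae hG).1 (Lp.memLp G)
  have hB : MemLp (fun a => b a + ‖g a‖) p μ := hb.add hg.norm
  have hfin := lintegral_rpow_enorm_lt_top_of_eLpNorm_lt_top hp0 hp hB.eLpNorm_lt_top
  have hint : Tendsto (fun i => ∫⁻ a, ‖f i a - g a‖ₑ ^ p.toReal ∂μ) l (𝓝 0) := by
    rw [← lintegral_zero (μ := μ)]
    refine tendsto_lintegral_filter_of_dominated_convergence' _ ?_ ?_ hfin.ne ?_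
    · filter_upwards [hF] with i hi
      exact ((((Lp.aestronglyMeasurable (F i)).congr hi).sub hg.1).enorm).pow_const _
    · filter_upwards [hfb] with i hi
      filter_upwards [hi] with a ha
      refine ENNReal.rpow_le_rpow ?_ hpos.le
      rw [enorm_le_iff_norm_le]
      exact (norm_sub_le _ _).trans ((by gcongr : _ ≤ b a + ‖g a‖).trans (le_abs_self _))
    · filter_upwards [hlim] with a ha
      have h1 : Tendsto (fun i => ‖f i a - g a‖ₑ) l (𝓝 0) := by
        simpa using (ha.sub_const (g a)).enorm
      simpa [ENNReal.zero_rpow_of_pos hpos] using h1.ennrpow_const p.toReal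
  rw [Lp.tendsto_Lp_iff_tendsto_eLpNorm']
  have hroot : Tendsto (fun i => (∫⁻ a, ‖f i a - g a‖ₑ ^ p.toReal ∂μ) ^ (1 / p.toReal)) l
      (𝓝 0) := by
    simpa [ENNReal.zero_rpow_of_pos (inv_pos.2 hpos)] using hint.ennrpow_const (1 / p.toReal)
  refine hroot.congr' ?_
  filter_upwards [hF] with i hi
  rw [← eLpNorm_eq_lintegral_rpow_enorm_toReal hp0 hp]
  exact (eLpNorm_congr_ae (hi.sub hG)).symm

theorem exp_mul_le_one_add_exp_mul {r s : ℝ} (hs : 0 ≤ s) (hsr : s ≤ r) (x : ℝ) :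
    Real.exp (s * x) ≤ 1 + Real.exp (r * x) := by
  rcases le_total x 0 with hx | hx
  · have : Real.exp (s * x) ≤ 1 := Real.exp_le_one_iff.2 (mul_nonpos_of_nonneg_of_nonpos hs hx)
    linarith [Real.exp_pos (r * x)]
  · have : Real.exp (s * x) ≤ Real.exp (r * x) := by gcongr
    linarith

theorem exp_mul_add_mul_abs_le {r s d : ℝ} (hd : d ≤ s) (hd' : s + d ≤ r) (h0 : 0 ≤ d) (x : ℝ) :
    Real.exp (s * x + d * |x|) ≤ 1 + Real.exp (r * x) := by
  rcases abs_cases x with ⟨hx, -⟩ | ⟨hx, -⟩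
  · rw [hx, ← add_mul]
    exact exp_mul_le_one_add_exp_mul (by linarith) hd' x
  · rw [hx, mul_neg, ← sub_eq_add_neg, ← sub_mul]
    exact exp_mul_le_one_add_exp_mul (by linarith) (by linarith) x

theorem abs_le_inv_mul_exp {d : ℝ} (hd : 0 < d) (x : ℝ) : |x| ≤ d⁻¹ * Real.exp (d * |x|) := by
  rw [inv_mul_eq_div, le_div_iff₀ hd]
  linarith [Real.add_one_le_exp (d * |x|)]

theorem norm_exp_mul_ofReal (z : ℂ) (x : ℝ) :
    ‖Complex.exp (z * (x : ℂ))‖ = Real.exp (z.re * x) := by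
  simp [Complex.norm_exp]

theorem norm_ofReal_mul_exp_le {r d : ℝ} {z : ℂ} (hd : 0 < d) (hdz : d ≤ z.re)
    (hzd : z.re + d ≤ r) (x : ℝ) :
    ‖(x : ℂ) * Complex.exp (z * (x : ℂ))‖ ≤ d⁻¹ * (1 + Real.exp (r * x)) := by
  rw [norm_mul, norm_exp_mul_ofReal, Complex.norm_real, Real.norm_eq_abs]
  calc |x| * Real.exp (z.re * x)
      ≤ d⁻¹ * Real.exp (d * |x|) * Real.exp (z.re * x) := by
        gcongr
        exact abs_le_inv_mul_exp hd x
    _ = d⁻¹ * Real.exp (z.re * x + d * |x|) := by rw [Real.exp_add]; ring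
    _ ≤ _ := by
        gcongr
        exact exp_mul_add_mul_abs_le hdz hzd hd.le x

theorem norm_slope_exp_mul_le {r d : ℝ} {z h : ℂ} (hd : 0 < d) (hdz : 2 * d ≤ z.re)
    (hzd : z.re + 2 * d ≤ r) (hh : h ≠ 0) (hhd : ‖h‖ ≤ d) (x : ℝ) :
    ‖h⁻¹ * (Complex.exp ((z + h) * (x : ℂ)) - Complex.exp (z * (x : ℂ)))‖
      ≤ d⁻¹ * (1 + Real.exp (r * x)) := by
  have hexp : ‖Complex.exp (h * x) - 1‖ ≤ ‖h‖ * |x| * Real.exp (d * |x|) := by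
    have := Complex.norm_exp_sub_sum_le_norm_mul_exp (h * x) 1
    simp only [Finset.range_one, Finset.sum_singleton, pow_zero, Nat.factorial_zero, Nat.cast_one,
      div_one, pow_one, norm_mul, Complex.norm_real, Real.norm_eq_abs] at this
    refine this.trans ?_
    gcongr
  have hpos : 0 < ‖h‖ := norm_pos_iff.2 hh
  have hfac : Complex.exp ((z + h) * (x : ℂ)) - Complex.exp (z * (x : ℂ))
      = Complex.exp (z * x) * (Complex.exp (h * x) - 1) := by
    rw [add_mul, Complex.exp_add]; ring
  rw [hfac, norm_mul, norm_mul, norm_inv, norm_exp_mul_ofReal]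
  calc ‖h‖⁻¹ * (Real.exp (z.re * x) * ‖Complex.exp (h * x) - 1‖)
      ≤ ‖h‖⁻¹ * (Real.exp (z.re * x) * (‖h‖ * |x| * Real.exp (d * |x|))) := by gcongr
    _ = Real.exp (z.re * x) * Real.exp (d * |x|) * |x| := by field_simp
    _ ≤ Real.exp (z.re * x) * Real.exp (d * |x|) * (d⁻¹ * Real.exp (d * |x|)) := by
        gcongr
        exact abs_le_inv_mul_exp hd x
    _ = d⁻¹ * Real.exp (z.re * x + 2 * d * |x|) := by
        rw [show z.re * x + 2 * d * |x| = z.re * x + d * |x| + d * |x| by ring,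
          Real.exp_add, Real.exp_add]
        ring
    _ ≤ _ := by
        gcongr
        exact exp_mul_add_mul_abs_le hdz hzd (by linarith) x

/-- If `v ∈ L²(μ)` and `e^{rλ} v ∈ L²(μ)`, then for each `z` in the closed strip
`0 ≤ Re z ≤ r` the function `e^{zλ} v` lies in `L²(μ)`, the resulting `L²(μ)`-valued map
is continuous on the closed strip, and holomorphic on the open strip `0 < Re z < r`. -/
theorem holomorphic_extension_in_L2
    (μ : Measure ℝ) (r : ℝ) (hr : 0 < r) (v : ℝ → ℂ) (hv : Measurable v)
    (h0 : MemLp v 2 μ)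
    (h1 : MemLp (fun l => Real.exp (r * l) • v l) 2 μ) :
    (∀ z : ℂ, 0 ≤ z.re → z.re ≤ r →
      MemLp (fun l : ℝ => Complex.exp (z * (l : ℂ)) * v l) 2 μ) ∧
    ∃ F : ℂ → MeasureTheory.Lp ℂ 2 μ,
      (∀ z : ℂ, 0 ≤ z.re → z.re ≤ r →
        (F z : ℝ → ℂ) =ᵐ[μ] fun l : ℝ => Complex.exp (z * (l : ℂ)) * v l) ∧
      ContinuousOn F {z : ℂ | 0 ≤ z.re ∧ z.re ≤ r} ∧
      ∀ z : ℂ, 0 < z.re → z.re < r → DifferentiableAt ℂ F z := by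
  have hb : MemLp (fun l => (1 + Real.exp (r * l)) * ‖v l‖) 2 μ := by
    convert h0.norm.add h1.norm using 1
    ext l
    rw [Pi.add_apply, norm_smul, Real.norm_of_nonneg (Real.exp_pos _).le]
    ring
  have hbound : ∀ z : ℂ, 0 ≤ z.re → z.re ≤ r → ∀ l : ℝ,
      ‖Complex.exp (z * (l : ℂ)) * v l‖ ≤ (1 + Real.exp (r * l)) * ‖v l‖ := by
    intro z hz hzr l
    rw [norm_mul, norm_exp_mul_ofReal]
    gcongr
    exact exp_mul_le_one_add_exp_mul hz hzr l
  have hmem : ∀ z : ℂ, 0 ≤ z.re → z.re ≤ r →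
      MemLp (fun l : ℝ => Complex.exp (z * (l : ℂ)) * v l) 2 μ := fun z hz hzr =>
    hb.mono' (by fun_prop) (.of_forall (hbound z hz hzr))
  let F : ℂ → Lp ℂ 2 μ := fun z =>
    if h : 0 ≤ z.re ∧ z.re ≤ r then (hmem z h.1 h.2).toLp _ else 0
  have hF : ∀ z : ℂ, 0 ≤ z.re → z.re ≤ r →
      (F z : ℝ → ℂ) =ᵐ[μ] fun l : ℝ => Complex.exp (z * (l : ℂ)) * v l := by
    intro z hz hzr
    simp only [F, dif_pos (And.intro hz hzr)]
    exact (hmem z hz hzr).coeFn_toLp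
  refine ⟨hmem, F, hF, ?_, ?_⟩
  · rintro z ⟨hz, hzr⟩
    refine tendsto_Lp_of_dominated ENNReal.ofNat_ne_top
      (f := fun w l => Complex.exp (w * (l : ℂ)) * v l) ?_ (hF z hz hzr) hb ?_ ?_
    · filter_upwards [self_mem_nhdsWithin] with w hw using hF w hw.1 hw.2
    · filter_upwards [self_mem_nhdsWithin] with w hw using .of_forall (hbound w hw.1 hw.2)
    · refine .of_forall fun l => ?_
      have : Continuous fun w : ℂ => Complex.exp (w * (l : ℂ)) * v l := by fun_prop
      exact this.continuousWithinAt
  · intro z hz hzr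
    obtain ⟨d, hd, hdz, hzd⟩ : ∃ d : ℝ, 0 < d ∧ 2 * d ≤ z.re ∧ z.re + 2 * d ≤ r := by
      refine ⟨min z.re (r - z.re) / 2, half_pos (lt_min hz (sub_pos.2 hzr)), ?_, ?_⟩
      · linarith [min_le_left z.re (r - z.re)]
      · linarith [min_le_right z.re (r - z.re)]
    have hbd : MemLp (fun l => d⁻¹ * ((1 + Real.exp (r * l)) * ‖v l‖)) 2 μ := hb.const_mul _
    have hderiv : MemLp (fun l : ℝ => (l : ℂ) * Complex.exp (z * (l : ℂ)) * v l) 2 μ := by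
      refine hbd.mono' (by fun_prop) (.of_forall fun l => ?_)
      rw [norm_mul, ← mul_assoc]
      gcongr
      exact norm_ofReal_mul_exp_le hd (by linarith) (by linarith) l
    have hsmall : ∀ᶠ h : ℂ in 𝓝[≠] 0, h ≠ 0 ∧ ‖h‖ ≤ d := by
      filter_upwards [self_mem_nhdsWithin,
        mem_nhdsWithin_of_mem_nhds (Metric.closedBall_mem_nhds (0 : ℂ) hd)] with h h0 hhd
      exact ⟨h0, by simpa using hhd⟩
    suffices HasDerivAt F (hderiv.toLp _) z from this.differentiableAt
    rw [hasDerivAt_iff_tendsto_slope_zero]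
    refine tendsto_Lp_of_dominated ENNReal.ofNat_ne_top
      (f := fun h l => h⁻¹ * (Complex.exp ((z + h) * (l : ℂ)) * v l
        - Complex.exp (z * (l : ℂ)) * v l)) ?_ hderiv.coeFn_toLp hbd ?_ ?_
    · filter_upwards [hsmall] with h ⟨_, hhd⟩
      have hre := abs_le.1 ((Complex.abs_re_le_norm h).trans hhd)
      have hzh := hF (z + h) (by rw [Complex.add_re]; linarith) (by rw [Complex.add_re]; linarith)
      filter_upwards [Lp.coeFn_smul h⁻¹ (F (z + h) - F z), Lp.coeFn_sub (F (z + h)) (F z),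
        hzh, hF z hz.le hzr.le] with l h₁ h₂ h₃ h₄
      rw [h₁, Pi.smul_apply, h₂, Pi.sub_apply, h₃, h₄, smul_eq_mul]
    · filter_upwards [hsmall] with h ⟨hh, hhd⟩
      refine .of_forall fun l => ?_
      rw [← sub_mul, ← mul_assoc, norm_mul, ← mul_assoc]
      gcongr
      exact norm_slope_exp_mul_le hd hdz hzd hh hhd l
    · refine .of_forall fun l => ?_
      have : HasDerivAt (fun w : ℂ => Complex.exp (w * (l : ℂ)) * v l)
          ((l : ℂ) * Complex.exp (z * (l : ℂ)) * v l) z := by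
        have := ((hasDerivAt_mul_const (x := z) (l : ℂ)).cexp).mul_const (v l)
        rwa [mul_comm (Complex.exp _)] at this
      simpa only [smul_eq_mul] using hasDerivAt_iff_tendsto_slope_zero.1 this
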